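/- Let X be a Banach space with an approximation scheme (A_n). Fix r > 0 and 0 < ν ≤ ∞, and let Y := X^r_ν = {f ∈ X : (n^{r − 1/ν} α_n(f, X))_{n≥1} ∈ ℓ_ν}, equipped with the quasi-norm ‖f‖_Y = ‖f‖_X + ‖(n^{r − 1/ν} α_n(f, X))‖_{ℓ_ν}. Then the pair (X, Y) satisfies the Jackson inequality (there is C₁ > 0 with α_n(f, X) ≤ C₁ n^{−r} ‖f‖_Y for all f ∈ Y, n ≥ 1) and the Bernstein inequality (there is C₂ > 0 with ‖g‖_Y ≤ C₂ n^{r} ‖g‖_X for all g ∈ A_n, n ≥ 1); consequently, for every 0 < α < r and 0 < μ₁ ≤ ∞, (X, Y)_{α/r, μ₁} = X^α_{μ₁} with equivalence of quasi-norms. -/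

import Mathlib

open scoped ENNReal

/-- An approximation scheme on a Banach space `X`: a family of subsets `A n ⊆ X` with
`A 0 = {0}`, `A n ⊆ A (n+1)`, `λ • A n ⊆ A n`, `A m + A n ⊆ A (m+n)`, and `⋃ n, A n`
dense in `X`. -/
structure ApproximationScheme (X : Type*) [NormedAddCommGroup X] [NormedSpace ℂ X] where
  A : ℕ → Set X
  zero_eq : A 0 = {0}
  mono : ∀ n : ℕ, A n ⊆ A (n + 1)
  smul_mem : ∀ (c : ℂ) (n : ℕ), ∀ a ∈ A n, c • a ∈ A n
  add_mem : ∀ (m n : ℕ), ∀ a ∈ A m, ∀ b ∈ A n, a + b ∈ A (m + n)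
  dense : Dense (⋃ n : ℕ, A n)

variable {X : Type*} [NormedAddCommGroup X] [NormedSpace ℂ X]

/-- `approxError S f n` is the `(n+1)`-st approximation number `α_{n+1}(f, X)` of `f`
with respect to the scheme `S`. -/
noncomputable def approxError (S : ApproximationScheme X) (f : X) (n : ℕ) : ℝ :=
  sInf {c : ℝ | ∃ a ∈ S.A n, c = ‖f - a‖}

/-- The approximation-space quasi-norm `‖f‖_{X^ρ_μ} = ‖(n^{ρ - 1/μ} α_n(f, X))_n‖_{ℓ_μ}`,
valued in `ℝ≥0∞` (the exponent `ρ - 1/μ` is `ρ` when `μ = ∞`). -/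
noncomputable def apNorm (S : ApproximationScheme X) (ρ : ℝ) (μ : ℝ≥0∞) (f : X) : ℝ≥0∞ :=
  if μ = ∞ then ⨆ n : ℕ, ENNReal.ofReal (((n : ℝ) + 1) ^ ρ * approxError S f n)
  else (∑' n : ℕ, ENNReal.ofReal
      ((((n : ℝ) + 1) ^ (ρ - (μ⁻¹).toReal) * approxError S f n) ^ μ.toReal)) ^
    (1 / μ.toReal)

/-- The quasi-norm of `Y := X^r_ν`: `‖f‖_Y = ‖f‖_X + ‖(n^{r - 1/ν} α_n(f, X))_n‖_{ℓ_ν}`. -/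
noncomputable def Ynorm (S : ApproximationScheme X) (r : ℝ) (ν : ℝ≥0∞) (f : X) : ℝ :=
  ‖f‖ + (apNorm S r ν f).toReal

/-- The K-functional of the pair `(X, Y)` for `Y := X^r_ν` (as a subspace of `X` with
quasi-norm `Ynorm`): `K(f, t) = inf {‖f - g‖_X + t ‖g‖_Y : g ∈ Y}`. -/
noncomputable def KfunY (S : ApproximationScheme X) (r : ℝ) (ν : ℝ≥0∞) (f : X)
    (t : ℝ) : ℝ :=
  sInf {c : ℝ | ∃ g : X, apNorm S r ν g ≠ ∞ ∧ c = ‖f - g‖ + t * Ynorm S r ν g}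

/-- The real-interpolation (quasi-)norm `‖f‖_{θ,μ}` of the pair `(X, X^r_ν)`,
valued in `ℝ≥0∞`. -/
noncomputable def interpNormY (S : ApproximationScheme X) (r : ℝ) (ν : ℝ≥0∞)
    (θ : ℝ) (μ : ℝ≥0∞) (f : X) : ℝ≥0∞ :=
  if μ = ∞ then ⨆ t ∈ Set.Ioi (0 : ℝ), ENNReal.ofReal (t ^ (-θ) * KfunY S r ν f t)
  else (∫⁻ t in Set.Ioi (0 : ℝ),
      ENNReal.ofReal ((t ^ (-θ) * KfunY S r ν f t) ^ μ.toReal / t)) ^ (1 / μ.toReal)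


lemma rp_le {x y : ℝ} (s : ℝ) (hx : 0 < x) (h1 : x ≤ y) (h2 : y ≤ 2 * x) :
    y ^ s ≤ 2 ^ |s| * x ^ s := by
  have hy : 0 < y := hx.trans_le h1
  rcases le_total 0 s with h | h
  · rw [abs_of_nonneg h, ← Real.mul_rpow (by norm_num) hx.le]
    exact Real.rpow_le_rpow hy.le h2 h
  · have := Real.rpow_le_rpow_of_nonpos hx h1 h
    have h3 : (1:ℝ) ≤ 2 ^ |s| := Real.one_le_rpow (by norm_num) (abs_nonneg s)
    nlinarith [Real.rpow_pos_of_pos hx s]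

lemma rp_ge {x y : ℝ} (s : ℝ) (hx : 0 < x) (h1 : x ≤ y) (h2 : y ≤ 2 * x) :
    x ^ s ≤ 2 ^ |s| * y ^ s := by
  have hy : 0 < y := hx.trans_le h1
  have := rp_le (-s) hx h1 h2
  rw [Real.rpow_neg hx.le, Real.rpow_neg hy.le, abs_neg] at this
  have hxs := Real.rpow_pos_of_pos hx s
  have hys := Real.rpow_pos_of_pos hy s
  field_simp at this
  linarith

lemma rp_mvt (s : ℝ) {x : ℝ} (hx : 1 ≤ x) :
    ∃ ξ : ℝ, x ≤ ξ ∧ ξ ≤ 2 * x ∧ (x + 1) ^ s - x ^ s = s * ξ ^ (s - 1) := by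
  obtain ⟨c, hc, h⟩ := exists_hasDerivAt_eq_slope (fun t : ℝ => t ^ s)
    (fun t => s * t ^ (s - 1)) (show x < x + 1 by linarith)
    (by
      intro t ht
      exact (Real.continuousAt_rpow_const t s (Or.inl (by linarith [ht.1]))).continuousWithinAt)
    (by
      intro t ht
      exact Real.hasDerivAt_rpow_const (Or.inl (by linarith [ht.1])))
  refine ⟨c, hc.1.le, by linarith [hc.2], ?_⟩
  rw [h]; simp

lemma rp_diff (s : ℝ) (hs : 0 < s) : ∃ A : ℝ, 0 < A ∧ ∀ x : ℝ, 1 ≤ x →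
    x ^ (s - 1) ≤ A * ((x + 1) ^ s - x ^ s) ∧ (x + 1) ^ s - x ^ s ≤ A * x ^ (s - 1) := by
  have hB : (0:ℝ) < 2 ^ |s - 1| := by positivity
  refine ⟨2 ^ |s - 1| * (s + s⁻¹), by positivity, fun x hx => ?_⟩
  obtain ⟨ξ, h1, h2, h⟩ := rp_mvt s hx
  have hx0 : 0 < x := by linarith
  have hξ0 : 0 < ξ := by linarith
  have ha := rp_le (s - 1) hx0 h1 h2
  have hb := rp_ge (s - 1) hx0 h1 h2
  have hp := Real.rpow_pos_of_pos hξ0 (s - 1)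
  have hq := Real.rpow_pos_of_pos hx0 (s - 1)
  rw [h]
  constructor
  · calc x ^ (s - 1) ≤ 2 ^ |s - 1| * ξ ^ (s - 1) := hb
      _ = 2 ^ |s - 1| * s⁻¹ * (s * ξ ^ (s - 1)) := by field_simp
      _ ≤ _ := by gcongr; linarith
  · calc s * ξ ^ (s - 1) ≤ s * (2 ^ |s - 1| * x ^ (s - 1)) := by gcongr
      _ = 2 ^ |s - 1| * s * x ^ (s - 1) := by ring
      _ ≤ _ := by
        gcongr
        have : 0 < s⁻¹ := by positivity
        linarith

lemma rp_diff_neg (s : ℝ) (hs : 0 < s) : ∃ A : ℝ, 0 < A ∧ ∀ x : ℝ, 1 ≤ x →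
    x ^ (-s - 1) ≤ A * (x ^ (-s) - (x + 1) ^ (-s)) ∧
    x ^ (-s) - (x + 1) ^ (-s) ≤ A * x ^ (-s - 1) := by
  have hB : (0:ℝ) < 2 ^ |-s - 1| := by positivity
  refine ⟨2 ^ |-s - 1| * (s + s⁻¹), by positivity, fun x hx => ?_⟩
  obtain ⟨ξ, h1, h2, h⟩ := rp_mvt (-s) hx
  have hx0 : 0 < x := by linarith
  have hξ0 : 0 < ξ := by linarith
  have ha := rp_le (-s - 1) hx0 h1 h2
  have hb := rp_ge (-s - 1) hx0 h1 h2
  have hp := Real.rpow_pos_of_pos hξ0 (-s - 1)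
  have hq := Real.rpow_pos_of_pos hx0 (-s - 1)
  have h' : x ^ (-s) - (x + 1) ^ (-s) = s * ξ ^ (-s - 1) := by linarith
  rw [h']
  constructor
  · calc x ^ (-s - 1) ≤ 2 ^ |-s - 1| * ξ ^ (-s - 1) := hb
      _ = 2 ^ |-s - 1| * s⁻¹ * (s * ξ ^ (-s - 1)) := by field_simp
      _ ≤ _ := by gcongr; linarith
  · calc s * ξ ^ (-s - 1) ≤ s * (2 ^ |-s - 1| * x ^ (-s - 1)) := by gcongr
      _ = 2 ^ |-s - 1| * s * x ^ (-s - 1) := by ring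
      _ ≤ _ := by
        gcongr
        have : 0 < s⁻¹ := by positivity
        linarith

lemma pow_sum (s : ℝ) (hs : 0 < s) : ∃ c : ℝ, 0 < c ∧ ∀ m : ℕ,
    ((m:ℝ) + 1) ^ s ≤ c * ∑ k ∈ Finset.range (m + 1), ((k:ℝ) + 1) ^ (s - 1) ∧
    ∑ k ∈ Finset.range (m + 1), ((k:ℝ) + 1) ^ (s - 1) ≤ c * ((m:ℝ) + 1) ^ s := by
  obtain ⟨A, hA, h⟩ := rp_diff s hs
  have hB : (0:ℝ) < 2 ^ |s - 1| := by positivity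
  have hAB : 0 < A * 2 ^ |s - 1| := by positivity
  refine ⟨1 + A * 2 ^ |s - 1|, by positivity, fun m => ?_⟩
  induction m with
  | zero => simp; exact hAB.le
  | succ m ih =>
    obtain ⟨i1, i2⟩ := ih
    have hm : (1:ℝ) ≤ (m:ℝ) + 1 := by have := Nat.cast_nonneg (α := ℝ) m; linarith
    obtain ⟨d1, d2⟩ := h _ hm
    have e1 := rp_le (s - 1) (x := (m:ℝ) + 1) (y := (m:ℝ) + 1 + 1) (by linarith) (by linarith) (by linarith)
    have e2 := rp_ge (s - 1) (x := (m:ℝ) + 1) (y := (m:ℝ) + 1 + 1) (by linarith) (by linarith) (by linarith)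
    have hp : (0:ℝ) < ((m:ℝ) + 1 + 1) ^ (s - 1) := by positivity
    have hp' : (0:ℝ) < ((m:ℝ) + 1) ^ (s - 1) := by positivity
    have hd : 0 ≤ ((m:ℝ) + 1 + 1) ^ s - ((m:ℝ) + 1) ^ s := by
      by_contra hc
      push Not at hc
      nlinarith
    rw [Finset.sum_range_succ _ (m + 1)]
    push_cast
    constructor
    · have : A * ((m:ℝ) + 1) ^ (s - 1) ≤ A * (2 ^ |s - 1| * ((m:ℝ) + 1 + 1) ^ (s - 1)) := by gcongr
      nlinarith
    · have : 2 ^ |s - 1| * ((m:ℝ) + 1) ^ (s - 1) ≤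
        2 ^ |s - 1| * (A * (((m:ℝ) + 1 + 1) ^ s - ((m:ℝ) + 1) ^ s)) := by gcongr
      nlinarith

lemma tail_sum (s : ℝ) (hs : 0 < s) : ∃ c : ℝ, 0 < c ∧ ∀ m : ℕ,
    ∑' n : ℕ, (if m ≤ n then ENNReal.ofReal (((n:ℝ) + 1) ^ (-s - 1)) else 0) ≤
      ENNReal.ofReal (c * ((m:ℝ) + 1) ^ (-s)) := by
  obtain ⟨A, hA, h⟩ := rp_diff_neg s hs
  refine ⟨A, hA, fun m => ?_⟩
  apply ENNReal.tsum_le_of_sum_range_le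
  intro N
  have key : ∑ n ∈ Finset.range N, (if m ≤ n then ((n:ℝ) + 1) ^ (-s - 1) else 0) ≤
      if m ≤ N then A * (((m:ℝ) + 1) ^ (-s) - ((N:ℝ) + 1) ^ (-s)) else 0 := by
    induction N with
    | zero =>
      rcases Nat.eq_zero_or_pos m with rfl | hm
      · simp
      · simp [hm.ne']
    | succ N ih =>
      rw [Finset.sum_range_succ]
      have hN : (1:ℝ) ≤ (N:ℝ) + 1 := by have := Nat.cast_nonneg (α := ℝ) N; linarith
      obtain ⟨d1, d2⟩ := h _ hN
      by_cases h1 : m ≤ N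
      · rw [if_pos h1] at ih ⊢
        rw [if_pos (by omega)]
        push_cast
        linarith
      · rw [if_neg h1] at ih ⊢
        by_cases h2 : m ≤ N + 1
        · obtain rfl : m = N + 1 := by omega
          simp at ih ⊢
          simpa using ih
        · rw [if_neg h2]; linarith
  calc ∑ n ∈ Finset.range N, (if m ≤ n then ENNReal.ofReal (((n:ℝ) + 1) ^ (-s - 1)) else 0)
      = ENNReal.ofReal (∑ n ∈ Finset.range N, (if m ≤ n then ((n:ℝ) + 1) ^ (-s - 1) else 0)) := by
        rw [ENNReal.ofReal_sum_of_nonneg]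
        · refine Finset.sum_congr rfl fun n _ => ?_
          split_ifs <;> simp
        · intro n _
          split_ifs <;> positivity
    _ ≤ _ := by
      apply ENNReal.ofReal_le_ofReal
      refine key.trans ?_
      have h1 : 0 < ((N:ℝ) + 1) ^ (-s) := by positivity
      have h2 : 0 < ((m:ℝ) + 1) ^ (-s) := by positivity
      split_ifs
      · gcongr; linarith
      · positivity

lemma w_eq (ρ p : ℝ) (hp : 0 < p) (n : ℕ) (e : ℝ) (he : 0 ≤ e) :
    (((n:ℝ) + 1) ^ (ρ - 1 / p) * e) ^ p = ((n:ℝ) + 1) ^ (ρ * p - 1) * e ^ p := by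
  rw [Real.mul_rpow (by positivity) he, ← Real.rpow_mul (by positivity)]
  congr 2
  field_simp

/-- sup is dominated by the sum -/
lemma sup_le_sum (ρ p : ℝ) (hρ : 0 < ρ) (hp : 0 < p) : ∃ c : ℝ, 0 < c ∧ ∀ E : ℕ → ℝ,
    Antitone E → (∀ n, 0 ≤ E n) → ∀ m n : ℕ, m ≤ n → (((m:ℝ) + 1) ^ ρ * E m) ^ p ≤
      c * ∑ k ∈ Finset.range (n + 1), ((k:ℝ) + 1) ^ (ρ * p - 1) * E k ^ p := by
  obtain ⟨c, hc, h⟩ := pow_sum (ρ * p) (by positivity)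
  refine ⟨c, hc, fun E hE hE0 m n hmn => ?_⟩
  rw [Real.mul_rpow (by positivity) (hE0 m), ← Real.rpow_mul (by positivity)]
  calc ((m:ℝ) + 1) ^ (ρ * p) * E m ^ p
      ≤ (c * ∑ k ∈ Finset.range (m + 1), ((k:ℝ) + 1) ^ (ρ * p - 1)) * E m ^ p := by
        have := Real.rpow_nonneg (hE0 m) p
        gcongr
        exact (h m).1
    _ = c * ∑ k ∈ Finset.range (m + 1), ((k:ℝ) + 1) ^ (ρ * p - 1) * E m ^ p := by
        rw [mul_assoc, Finset.sum_mul]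
    _ ≤ c * ∑ k ∈ Finset.range (m + 1), ((k:ℝ) + 1) ^ (ρ * p - 1) * E k ^ p := by
        gcongr with k hk
        · exact hE0 m
        · exact hE (by simp at hk; omega)
    _ ≤ _ := by
        refine mul_le_mul_of_nonneg_left ?_ hc.le
        apply Finset.sum_le_sum_of_subset_of_nonneg
        · intro k; simp; omega
        · intro k _ _
          have := Real.rpow_nonneg (hE0 k) p
          positivity


lemma A_zero (S : ApproximationScheme X) (n : ℕ) : (0:X) ∈ S.A n := by
  induction n with
  | zero => rw [S.zero_eq]; rfl
  | succ n ih => exact S.mono n ih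

lemma A_mono (S : ApproximationScheme X) : Monotone S.A := monotone_nat_of_le_succ S.mono

lemma ae_bdd (S : ApproximationScheme X) (f : X) (n : ℕ) :
    BddBelow {c : ℝ | ∃ a ∈ S.A n, c = ‖f - a‖} :=
  ⟨0, by rintro _ ⟨a, _, rfl⟩; positivity⟩

lemma ae_le (S : ApproximationScheme X) (f : X) (n : ℕ) {a : X} (ha : a ∈ S.A n) :
    approxError S f n ≤ ‖f - a‖ := csInf_le (ae_bdd S f n) ⟨a, ha, rfl⟩

lemma ae_ge (S : ApproximationScheme X) (f : X) (n : ℕ) {b : ℝ}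
    (h : ∀ a ∈ S.A n, b ≤ ‖f - a‖) : b ≤ approxError S f n :=
  le_csInf ⟨_, 0, A_zero S n, rfl⟩ (by rintro _ ⟨a, ha, rfl⟩; exact h a ha)

lemma ae_nonneg (S : ApproximationScheme X) (f : X) (n : ℕ) : 0 ≤ approxError S f n :=
  ae_ge S f n fun _ _ => norm_nonneg _

lemma ae_anti (S : ApproximationScheme X) (f : X) : Antitone (approxError S f) :=
  fun _ _ h => ae_ge S f _ fun _ ha => ae_le S f _ (A_mono S h ha)

lemma ae_zero (S : ApproximationScheme X) (f : X) : approxError S f 0 = ‖f‖ := by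
  apply le_antisymm
  · simpa using ae_le S f 0 (A_zero S 0)
  · apply ae_ge; intro a ha; rw [S.zero_eq] at ha; rw [ha]; simp

lemma ae_exists (S : ApproximationScheme X) (f : X) (n : ℕ) {e : ℝ} (he : 0 < e) :
    ∃ a ∈ S.A n, ‖f - a‖ < approxError S f n + e := by
  obtain ⟨_, ⟨a, ha, rfl⟩, h⟩ := exists_lt_of_csInf_lt
    (s := {c : ℝ | ∃ a ∈ S.A n, c = ‖f - a‖}) ⟨_, 0, A_zero S n, rfl⟩
    (show sInf _ < approxError S f n + e from lt_add_of_pos_right _ he)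
  exact ⟨a, ha, h⟩

lemma ae_lip (S : ApproximationScheme X) (f g : X) (n : ℕ) :
    approxError S f n ≤ ‖f - g‖ + approxError S g n := by
  rw [← sub_le_iff_le_add']
  apply ae_ge
  intro a ha
  have := ae_le S f n ha
  have h2 : ‖f - a‖ ≤ ‖f - g‖ + ‖g - a‖ := by
    simpa using norm_add_le (f - g) (g - a)
  linarith

lemma ae_eq_zero (S : ApproximationScheme X) {g : X} {n k : ℕ} (hg : g ∈ S.A n) (h : n ≤ k) :
    approxError S g k = 0 :=
  le_antisymm (by simpa using ae_le S g k (A_mono S h hg)) (ae_nonneg _ _ _)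

lemma apNorm_top (S : ApproximationScheme X) (ρ : ℝ) (f : X) :
    apNorm S ρ ∞ f = ⨆ n : ℕ, ENNReal.ofReal (((n : ℝ) + 1) ^ ρ * approxError S f n) := by
  simp [apNorm]

lemma apNorm_fin (S : ApproximationScheme X) (ρ : ℝ) {μ : ℝ≥0∞} (h0 : 0 < μ) (h : μ ≠ ∞) (f : X) :
    apNorm S ρ μ f = (∑' n : ℕ, ENNReal.ofReal
      (((n : ℝ) + 1) ^ (ρ * μ.toReal - 1) * approxError S f n ^ μ.toReal)) ^ (1 / μ.toReal) := by
  simp only [apNorm, if_neg h]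
  have hp : 0 < μ.toReal := ENNReal.toReal_pos h0.ne' h
  congr 1
  refine tsum_congr fun n => ?_
  rw [ENNReal.toReal_inv, ← one_div, w_eq ρ _ hp n _ (ae_nonneg _ _ _)]

lemma jackson (S : ApproximationScheme X) (r : ℝ) (hr : 0 < r) (ν : ℝ≥0∞) (hν : 0 < ν) :
    ∃ C₁ : ℝ, 0 < C₁ ∧ ∀ f : X, apNorm S r ν f ≠ ∞ →
      ∀ n : ℕ, approxError S f n ≤ C₁ * ((n : ℝ) + 1) ^ (-r) * Ynorm S r ν f := by
  suffices H : ∃ C₁ : ℝ, 0 < C₁ ∧ ∀ f : X, ∀ n : ℕ,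
      ENNReal.ofReal (((n:ℝ) + 1) ^ r * approxError S f n) ≤ ENNReal.ofReal C₁ * apNorm S r ν f by
    obtain ⟨C, hC, H⟩ := H
    refine ⟨C, hC, fun f hf n => ?_⟩
    have h1 := ENNReal.toReal_mono (ENNReal.mul_ne_top ENNReal.ofReal_ne_top hf) (H f n)
    have hp : 0 < ((n:ℝ) + 1) ^ r := by positivity
    rw [ENNReal.toReal_ofReal (mul_nonneg hp.le (ae_nonneg _ _ _)), ENNReal.toReal_mul,
      ENNReal.toReal_ofReal hC.le] at h1
    rw [Real.rpow_neg (by positivity), Ynorm]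
    have h2 : C * (apNorm S r ν f).toReal ≤ C * (‖f‖ + (apNorm S r ν f).toReal) := by
      gcongr; linarith [norm_nonneg f]
    calc approxError S f n = (((n:ℝ) + 1) ^ r)⁻¹ * (((n:ℝ) + 1) ^ r * approxError S f n) := by
          field_simp
      _ ≤ (((n:ℝ) + 1) ^ r)⁻¹ * (C * (‖f‖ + (apNorm S r ν f).toReal)) := by
          exact mul_le_mul_of_nonneg_left (h1.trans h2) (by positivity)
      _ = _ := by ring
  by_cases h : ν = ∞
  · subst h
    refine ⟨1, one_pos, fun f n => ?_⟩
    rw [apNorm_top, ENNReal.ofReal_one, one_mul]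
    exact le_iSup (fun n : ℕ => ENNReal.ofReal (((n : ℝ) + 1) ^ r * approxError S f n)) n
  · have hp : 0 < ν.toReal := ENNReal.toReal_pos hν.ne' h
    obtain ⟨c, hc, H⟩ := sup_le_sum r ν.toReal hr hp
    refine ⟨c ^ (1 / ν.toReal), by positivity, fun f n => ?_⟩
    have h1 := H _ (ae_anti S f) (ae_nonneg S f) n n le_rfl
    rw [apNorm_fin S r hν h, ← ENNReal.ofReal_rpow_of_pos hc,
      ← ENNReal.mul_rpow_of_nonneg _ _ (by positivity), one_div, ENNReal.le_rpow_inv_iff hp,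
      ENNReal.ofReal_rpow_of_nonneg (mul_nonneg (by positivity) (ae_nonneg _ _ _)) hp.le]
    refine (ENNReal.ofReal_le_ofReal h1).trans ?_
    rw [ENNReal.ofReal_mul hc.le]
    gcongr
    rw [ENNReal.ofReal_sum_of_nonneg]
    · exact ENNReal.sum_le_tsum _
    · intro k _
      have := Real.rpow_nonneg (ae_nonneg S f k) ν.toReal
      positivity

lemma bern_gen (S : ApproximationScheme X) (r β : ℝ) (hr : 0 < r) (hβ : β < r)
    (ν : ℝ≥0∞) (hν : 0 < ν) : ∃ C : ℝ, 0 < C ∧ ∀ n : ℕ, ∀ g ∈ S.A (n + 1), ∀ M : ℝ, 0 ≤ M →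
      (∀ k ≤ n, ((k:ℝ) + 1) ^ β * approxError S g k ≤ M) →
      apNorm S r ν g ≤ ENNReal.ofReal (C * ((n:ℝ) + 1) ^ (r - β) * M) := by
  by_cases h : ν = ∞
  · subst h
    refine ⟨1, one_pos, fun n g hg M hM H => ?_⟩
    rw [apNorm_top, one_mul]
    refine iSup_le fun k => ENNReal.ofReal_le_ofReal ?_
    rcases le_or_gt k n with hk | hk
    · calc ((k:ℝ) + 1) ^ r * approxError S g k
          = ((k:ℝ) + 1) ^ (r - β) * (((k:ℝ) + 1) ^ β * approxError S g k) := by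
            rw [← mul_assoc, ← Real.rpow_add (by positivity)]; simp
        _ ≤ ((n:ℝ) + 1) ^ (r - β) * M := by
            have h1 := H k hk
            have h0 : 0 ≤ ((k:ℝ) + 1) ^ β * approxError S g k :=
              mul_nonneg (by positivity) (ae_nonneg _ _ _)
            have : 0 ≤ r - β := by linarith
            gcongr
    · rw [ae_eq_zero S hg hk, mul_zero]; positivity
  · have hp : 0 < ν.toReal := ENNReal.toReal_pos hν.ne' h
    set p := ν.toReal with hpdef
    obtain ⟨c, hc, hs⟩ := pow_sum ((r - β) * p) (mul_pos (by linarith) hp)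
    refine ⟨c ^ (1 / p), by positivity, fun n g hg M hM H => ?_⟩
    rw [apNorm_fin S r hν h, ← hpdef, one_div, ENNReal.rpow_inv_le_iff hp,
      ENNReal.ofReal_rpow_of_nonneg (by positivity) hp.le,
      Real.mul_rpow (by positivity) hM, Real.mul_rpow (by positivity) (by positivity),
      ← Real.rpow_mul hc.le, ← Real.rpow_mul (by positivity)]
    rw [inv_mul_cancel₀ hp.ne', Real.rpow_one]
    rw [tsum_eq_sum (s := Finset.range (n + 1))]
    · rw [← ENNReal.ofReal_sum_of_nonneg]
      · apply ENNReal.ofReal_le_ofReal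
        calc _ ≤ ∑ k ∈ Finset.range (n + 1), ((k:ℝ) + 1) ^ ((r - β) * p - 1) * M ^ p := by
              refine Finset.sum_le_sum fun k hk => ?_
              have h1 := H k (by simp at hk; omega)
              have h0 : 0 ≤ ((k:ℝ) + 1) ^ β * approxError S g k :=
                mul_nonneg (by positivity) (ae_nonneg _ _ _)
              calc ((k:ℝ) + 1) ^ (r * p - 1) * approxError S g k ^ p
                  = ((k:ℝ) + 1) ^ ((r - β) * p - 1) * (((k:ℝ) + 1) ^ β * approxError S g k) ^ p := by
                    rw [Real.mul_rpow (by positivity) (ae_nonneg _ _ _),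
                      ← Real.rpow_mul (by positivity), ← mul_assoc,
                      ← Real.rpow_add (by positivity)]
                    congr 2; ring
                _ ≤ _ := by gcongr
          _ = (∑ k ∈ Finset.range (n + 1), ((k:ℝ) + 1) ^ ((r - β) * p - 1)) * M ^ p := by
              rw [Finset.sum_mul]
          _ ≤ _ := by gcongr; exact (hs n).2
      · intro k _
        have := Real.rpow_nonneg (ae_nonneg S g k) p
        positivity
    · intro k hk
      rw [ae_eq_zero S hg (by simp at hk; omega), Real.zero_rpow hp.ne']; simp

lemma I_facts (r α : ℝ) (hr : 0 < r) (hα : 0 < α) (K : ℝ → ℝ) (hK0 : ∀ t, 0 < t → 0 ≤ K t)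
    (h1 : ∀ s t, 0 < t → t ≤ s → K t ≤ K s)
    (h2 : ∀ s t, 0 < t → t ≤ s → K s ≤ s / t * K t) (n : ℕ) (t : ℝ)
    (ht : t ∈ Set.Ioc (((n:ℝ) + 1 + 1) ^ (-r)) (((n:ℝ) + 1) ^ (-r))) :
    0 < t ∧ t ^ (-(α / r)) * K t ≤ 2 ^ α * (((n:ℝ) + 1) ^ α * K (((n:ℝ) + 1) ^ (-r))) ∧
    ((n:ℝ) + 1) ^ α * K (((n:ℝ) + 1) ^ (-r)) ≤ 2 ^ r * (t ^ (-(α / r)) * K t) ∧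
    ((n:ℝ) + 1) ^ r ≤ 1 / t ∧ 1 / t ≤ 2 ^ r * ((n:ℝ) + 1) ^ r := by
  have hn : (1:ℝ) ≤ (n:ℝ) + 1 := by have := Nat.cast_nonneg (α := ℝ) n; linarith
  have hn0 : (0:ℝ) < (n:ℝ) + 1 := by linarith
  have hn1 : (0:ℝ) < (n:ℝ) + 1 + 1 := by linarith
  have hlow : 0 < ((n:ℝ) + 1 + 1) ^ (-r) := by positivity
  have ht0 : 0 < t := hlow.trans ht.1
  have hu : ((n:ℝ) + 1 + 1) ^ r ≤ 2 ^ r * ((n:ℝ) + 1) ^ r := by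
    rw [← Real.mul_rpow (by norm_num) hn0.le]
    exact Real.rpow_le_rpow hn1.le (by linarith) hr.le
  have hinv1 : ((n:ℝ) + 1) ^ r ≤ 1 / t := by
    rw [le_div_iff₀ ht0]
    have := ht.2
    rw [Real.rpow_neg hn0.le] at this
    have hp : 0 < ((n:ℝ) + 1) ^ r := by positivity
    calc _ ≤ ((n:ℝ) + 1) ^ r * (((n:ℝ) + 1) ^ r)⁻¹ := by gcongr
      _ = 1 := mul_inv_cancel₀ hp.ne'
  have hinv2' : 1 / t ≤ ((n:ℝ) + 1 + 1) ^ r := by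
    rw [div_le_iff₀ ht0]
    have := ht.1.le
    rw [Real.rpow_neg hn1.le] at this
    have hp : 0 < ((n:ℝ) + 1 + 1) ^ r := by positivity
    calc 1 = ((n:ℝ) + 1 + 1) ^ r * (((n:ℝ) + 1 + 1) ^ r)⁻¹ := (mul_inv_cancel₀ hp.ne').symm
      _ ≤ _ := by gcongr
  have hinv2 := hinv2'.trans hu
  have hpw : ∀ x : ℝ, 0 < x → (x ^ r) ^ (α / r) = x ^ α := by
    intro x hx
    rw [← Real.rpow_mul hx.le]; congr 1; field_simp
  have htθ : t ^ (-(α / r)) = (1 / t) ^ (α / r) := by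
    rw [Real.rpow_neg ht0.le, one_div, Real.inv_rpow ht0.le]
  have hθ : 0 < α / r := by positivity
  have hlo : ((n:ℝ) + 1) ^ α ≤ t ^ (-(α / r)) := by
    rw [htθ, ← hpw _ hn0]
    exact Real.rpow_le_rpow (by positivity) hinv1 hθ.le
  have hhi : t ^ (-(α / r)) ≤ 2 ^ α * ((n:ℝ) + 1) ^ α := by
    rw [htθ]
    calc (1 / t) ^ (α / r) ≤ (((n:ℝ) + 1 + 1) ^ r) ^ (α / r) :=
          Real.rpow_le_rpow (by positivity) hinv2' hθ.le
      _ = ((n:ℝ) + 1 + 1) ^ α := hpw _ hn1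
      _ ≤ (2 * ((n:ℝ) + 1)) ^ α := Real.rpow_le_rpow hn1.le (by linarith) hα.le
      _ = _ := Real.mul_rpow (by norm_num) hn0.le
  have hKt := hK0 t ht0
  have hKn : 0 ≤ K (((n:ℝ) + 1) ^ (-r)) := hK0 _ (by positivity)
  have hk2 : K (((n:ℝ) + 1) ^ (-r)) ≤ 2 ^ r * K t := by
    refine (h2 _ t ht0 ht.2).trans ?_
    gcongr
    rw [div_eq_mul_one_div, Real.rpow_neg hn0.le, inv_mul_le_iff₀ (by positivity)]
    linarith
  refine ⟨ht0, ?_, ?_, hinv1, hinv2⟩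
  · calc _ ≤ (2 ^ α * ((n:ℝ) + 1) ^ α) * K (((n:ℝ) + 1) ^ (-r)) := by
          gcongr
          exact h1 _ _ ht0 ht.2
      _ = _ := by ring
  · calc _ ≤ t ^ (-(α / r)) * (2 ^ r * K t) := by gcongr
      _ = _ := by ring

lemma I_cover (r : ℝ) (hr : 0 < r) (t : ℝ) (h0 : 0 < t) (h1 : t ≤ 1) :
    ∃ n : ℕ, t ∈ Set.Ioc (((n:ℝ) + 1 + 1) ^ (-r)) (((n:ℝ) + 1) ^ (-r)) := by
  set x := t ^ (-(1 / r)) with hx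
  have hx1 : 1 ≤ x := Real.one_le_rpow_of_pos_of_le_one_of_nonpos h0 h1 (by
    have : 0 < 1 / r := by positivity
    linarith)
  have hx0 : 0 < x := by linarith
  have htx : t = x ^ (-r) := by
    rw [hx, ← Real.rpow_mul h0.le]
    have : -(1 / r) * -r = 1 := by field_simp
    rw [this, Real.rpow_one]
  obtain ⟨n, hn⟩ : ∃ n, ⌊x⌋₊ = n + 1 :=
    Nat.exists_eq_succ_of_ne_zero (Nat.floor_pos.2 hx1).ne'
  have ha := Nat.floor_le hx0.le
  have hb := Nat.lt_floor_add_one x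
  rw [hn] at ha hb
  push_cast at ha hb
  refine ⟨n, ?_, ?_⟩
  · rw [htx]
    exact Real.rpow_lt_rpow_of_neg hx0 hb (by linarith)
  · rw [htx]
    exact Real.rpow_le_rpow_of_nonpos (by positivity) ha (by linarith)

lemma interp_top (r α : ℝ) (hr : 0 < r) (hα : 0 < α) (β : ℝ) (hβ : α < β) (C₁ C₂ : ℝ)
    (hC₁ : 0 < C₁) (hC₂ : 0 < C₂) : ∃ c : ℝ, 0 < c ∧ ∀ (E : ℕ → ℝ) (K : ℝ → ℝ),
    (∀ n, 0 ≤ E n) → Antitone E → (∀ t, 0 < t → 0 ≤ K t) →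
    (∀ t, 0 < t → K t ≤ E 0) → (∀ s t, 0 < t → t ≤ s → K t ≤ K s) →
    (∀ s t, 0 < t → t ≤ s → K s ≤ s / t * K t) →
    (∀ n : ℕ, E n ≤ C₁ * K (((n:ℝ) + 1) ^ (-r))) →
    (∀ n : ℕ, ∀ M : ℝ, 0 ≤ M → (∀ k ≤ n, ((k:ℝ) + 1) ^ β * E k ≤ M) →
      K (((n:ℝ) + 1) ^ (-r)) ≤ C₂ * M * ((n:ℝ) + 1) ^ (-β)) →
    (⨆ t ∈ Set.Ioi (0 : ℝ), ENNReal.ofReal (t ^ (-(α / r)) * K t)) ≤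
      ENNReal.ofReal c * ⨆ n : ℕ, ENNReal.ofReal (((n : ℝ) + 1) ^ α * E n) ∧
    (⨆ n : ℕ, ENNReal.ofReal (((n : ℝ) + 1) ^ α * E n)) ≤
      ENNReal.ofReal c * ⨆ t ∈ Set.Ioi (0 : ℝ), ENNReal.ofReal (t ^ (-(α / r)) * K t) := by
  refine ⟨1 + C₁ + 2 ^ α * C₂, by positivity, fun E K hE0 hE hK0 h0 h1 h2 h3 h4 => ?_⟩
  constructor
  · set B := ⨆ n : ℕ, ENNReal.ofReal (((n : ℝ) + 1) ^ α * E n) with hB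
    by_cases hBt : B = ∞
    · rw [hBt, ENNReal.mul_top (by simp; positivity)]; exact le_top
    have hb : ∀ n : ℕ, ((n:ℝ) + 1) ^ α * E n ≤ B.toReal := by
      intro n
      rw [← ENNReal.ofReal_le_iff_le_toReal hBt]
      exact le_iSup (fun n : ℕ => ENNReal.ofReal (((n : ℝ) + 1) ^ α * E n)) n
    have hb0 : 0 ≤ B.toReal := ENNReal.toReal_nonneg
    rw [← ENNReal.ofReal_toReal hBt, ← ENNReal.ofReal_mul (by positivity)]
    refine iSup₂_le fun t ht => ENNReal.ofReal_le_ofReal ?_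
    have ht0 : 0 < t := ht
    rcases le_or_gt t 1 with h | h
    · obtain ⟨n, hn⟩ := I_cover r hr t ht0 h
      obtain ⟨-, i1, -⟩ := I_facts r α hr hα K hK0 h1 h2 n t hn
      refine i1.trans ?_
      have hk := h4 n (((n:ℝ) + 1) ^ (β - α) * B.toReal) (by positivity) (by
        intro k hk
        calc ((k:ℝ) + 1) ^ β * E k = ((k:ℝ) + 1) ^ (β - α) * (((k:ℝ) + 1) ^ α * E k) := by
              rw [← mul_assoc, ← Real.rpow_add (by positivity)]; simp
          _ ≤ _ := by
            have := hb k
            have := mul_nonneg (by positivity : 0 ≤ ((k:ℝ) + 1) ^ α) (hE0 k)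
            have : 0 ≤ β - α := by linarith
            gcongr
            )
      calc 2 ^ α * (((n:ℝ) + 1) ^ α * K (((n:ℝ) + 1) ^ (-r)))
          ≤ 2 ^ α * (((n:ℝ) + 1) ^ α * (C₂ * (((n:ℝ) + 1) ^ (β - α) * B.toReal) * ((n:ℝ) + 1) ^ (-β))) := by
            gcongr
        _ = 2 ^ α * C₂ * (((n:ℝ) + 1) ^ α * ((n:ℝ) + 1) ^ (β - α) * ((n:ℝ) + 1) ^ (-β)) * B.toReal := by ring
        _ = 2 ^ α * C₂ * B.toReal := by
            rw [← Real.rpow_add (by positivity), ← Real.rpow_add (by positivity)]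
            simp
        _ ≤ _ := by gcongr; linarith
    · calc t ^ (-(α / r)) * K t ≤ 1 * B.toReal := by
            have : t ^ (-(α / r)) ≤ 1 := Real.rpow_le_one_of_one_le_of_nonpos h.le (by
              have : 0 < α / r := by positivity
              linarith)
            have h5 := hb 0
            simp at h5
            have := hK0 t ht0
            have := h0 t ht0
            gcongr
            linarith
        _ ≤ _ := by
            gcongr
            have : 0 < 2 ^ α * C₂ := by positivity
            linarith
  · refine iSup_le fun n => ?_
    calc ENNReal.ofReal (((n : ℝ) + 1) ^ α * E n)
        ≤ ENNReal.ofReal ((1 + C₁ + 2 ^ α * C₂) *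
          ((((n : ℝ) + 1) ^ (-r)) ^ (-(α / r)) * K (((n:ℝ) + 1) ^ (-r)))) := by
          apply ENNReal.ofReal_le_ofReal
          have : (((n : ℝ) + 1) ^ (-r)) ^ (-(α / r)) = ((n : ℝ) + 1) ^ α := by
            rw [← Real.rpow_mul (by positivity)]; congr 1; field_simp
          rw [this]
          have hk := hK0 (((n:ℝ) + 1) ^ (-r)) (by positivity)
          calc ((n : ℝ) + 1) ^ α * E n ≤ ((n : ℝ) + 1) ^ α * (C₁ * K (((n:ℝ) + 1) ^ (-r))) := by
                gcongr; exact h3 n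
            _ = C₁ * (((n : ℝ) + 1) ^ α * K (((n:ℝ) + 1) ^ (-r))) := by ring
            _ ≤ _ := by
                gcongr
                have : 0 < 2 ^ α * C₂ := by positivity
                linarith
      _ ≤ _ := by
          rw [ENNReal.ofReal_mul (by positivity)]
          gcongr
          exact le_iSup₂ (f := fun t (_ : t ∈ Set.Ioi (0:ℝ)) => ENNReal.ofReal (t ^ (-(α / r)) * K t)) (((n:ℝ) + 1) ^ (-r))
            (show (0:ℝ) < ((n:ℝ) + 1) ^ (-r) by positivity)

/-- discrete Hardy -/
lemma hardy (r α p : ℝ) (hα : 0 < α) (hp : 0 < p) (β : ℝ) (hβ : α < β) (C₂ : ℝ)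
    (hC₂ : 0 < C₂) : ∃ c : ℝ, 0 < c ∧ ∀ (E : ℕ → ℝ) (K : ℝ → ℝ),
    (∀ n, 0 ≤ E n) → Antitone E → (∀ t, 0 < t → 0 ≤ K t) →
    (∀ n : ℕ, ∀ M : ℝ, 0 ≤ M → (∀ k ≤ n, ((k:ℝ) + 1) ^ β * E k ≤ M) →
      K (((n:ℝ) + 1) ^ (-r)) ≤ C₂ * M * ((n:ℝ) + 1) ^ (-β)) →
    ∑' n : ℕ, ENNReal.ofReal (((n:ℝ) + 1) ^ (α * p - 1) * K (((n:ℝ) + 1) ^ (-r)) ^ p) ≤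
    ENNReal.ofReal c * ∑' n : ℕ, ENNReal.ofReal (((n:ℝ) + 1) ^ (α * p - 1) * E n ^ p) := by
  obtain ⟨a, ha, hsup⟩ := sup_le_sum β p (by linarith) hp
  obtain ⟨b, hb, htail⟩ := tail_sum ((β - α) * p) (mul_pos (by linarith) hp)
  refine ⟨C₂ ^ p * a * b, by positivity, fun E K hE0 hE hK0 h4 => ?_⟩
  set w : ℕ → ℝ := fun k => ((k:ℝ) + 1) ^ (β * p - 1) * E k ^ p with hw
  have hw0 : ∀ k, 0 ≤ w k := fun k => mul_nonneg (by positivity) (Real.rpow_nonneg (hE0 k) p)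
  set v : ℕ → ℝ := fun n => ((n:ℝ) + 1) ^ (-((β - α) * p) - 1) with hv
  have hv0 : ∀ k, 0 ≤ v k := fun k => by simp only [hv]; positivity
  have step : ∀ n : ℕ, ((n:ℝ) + 1) ^ (α * p - 1) * K (((n:ℝ) + 1) ^ (-r)) ^ p ≤
      C₂ ^ p * a * (v n * ∑ k ∈ Finset.range (n + 1), w k) := by
    intro n
    have hs0 : 0 ≤ ∑ k ∈ Finset.range (n + 1), w k := Finset.sum_nonneg fun k _ => hw0 k
    have hk := h4 n ((a * ∑ k ∈ Finset.range (n + 1), w k) ^ (1 / p)) (by positivity) (by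
      intro k hk
      have := hsup E hE hE0 k n hk
      rw [one_div, Real.le_rpow_inv_iff_of_pos (mul_nonneg (by positivity) (hE0 k)) (by positivity) hp]
      exact this)
    have hk0 := hK0 (((n:ℝ) + 1) ^ (-r)) (by positivity)
    have hk' := Real.rpow_le_rpow hk0 hk hp.le
    rw [Real.mul_rpow (by positivity) (by positivity), Real.mul_rpow (by positivity) (by positivity),
      ← Real.rpow_mul (by positivity), ← Real.rpow_mul (by positivity),
      one_div, inv_mul_cancel₀ hp.ne', Real.rpow_one] at hk'
    calc _ ≤ ((n:ℝ) + 1) ^ (α * p - 1) * (C₂ ^ p * (a * ∑ k ∈ Finset.range (n + 1), w k) * ((n:ℝ) + 1) ^ (-β * p)) := by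
          gcongr
      _ = C₂ ^ p * a * ((((n:ℝ) + 1) ^ (α * p - 1) * ((n:ℝ) + 1) ^ (-β * p)) * ∑ k ∈ Finset.range (n + 1), w k) := by ring
      _ = _ := by
          rw [← Real.rpow_add (by positivity),
            show α * p - 1 + -β * p = -((β - α) * p) - 1 by ring]
  calc _ ≤ ∑' n : ℕ, ENNReal.ofReal (C₂ ^ p * a) * (∑' k : ℕ, if k ≤ n then ENNReal.ofReal (v n) * ENNReal.ofReal (w k) else 0) := by
        refine ENNReal.tsum_le_tsum fun n => ?_
        refine (ENNReal.ofReal_le_ofReal (step n)).trans ?_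
        rw [ENNReal.ofReal_mul (by positivity), ENNReal.ofReal_mul (hv0 n),
          ENNReal.ofReal_sum_of_nonneg (fun k _ => hw0 k), Finset.mul_sum]
        gcongr
        rw [tsum_eq_sum (s := Finset.range (n + 1))]
        · refine Finset.sum_le_sum fun k hk => ?_
          rw [if_pos (by simp at hk; omega)]
        · intro k hk
          rw [if_neg (by simp at hk; omega)]
    _ = ENNReal.ofReal (C₂ ^ p * a) * ∑' k : ℕ, ENNReal.ofReal (w k) * ∑' n : ℕ, if k ≤ n then ENNReal.ofReal (v n) else 0 := by
        rw [ENNReal.tsum_mul_left, ENNReal.tsum_comm]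
        congr 1
        refine tsum_congr fun k => ?_
        rw [← ENNReal.tsum_mul_left]
        refine tsum_congr fun n => ?_
        split_ifs
        · rw [mul_comm]
        · simp
    _ ≤ ENNReal.ofReal (C₂ ^ p * a) * ∑' k : ℕ, ENNReal.ofReal b * ENNReal.ofReal (((k:ℝ) + 1) ^ (α * p - 1) * E k ^ p) := by
        refine mul_le_mul' le_rfl (ENNReal.tsum_le_tsum fun k => ?_)
        refine (mul_le_mul' le_rfl (htail k)).trans ?_
        rw [← ENNReal.ofReal_mul (hw0 k), ← ENNReal.ofReal_mul hb.le]
        apply ENNReal.ofReal_le_ofReal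
        simp only [hw]
        have : ((k:ℝ) + 1) ^ (α * p - 1) = ((k:ℝ) + 1) ^ (β * p - 1) * ((k:ℝ) + 1) ^ (-((β - α) * p)) := by
          rw [← Real.rpow_add (by positivity)]; congr 1; ring
        rw [this]
        apply le_of_eq; ring
    _ = _ := by
        rw [ENNReal.tsum_mul_left, ← mul_assoc, ← ENNReal.ofReal_mul (by positivity)]

lemma interp_fin (r α p : ℝ) (hr : 0 < r) (hα : 0 < α) (hp : 0 < p) (β : ℝ) (hβ : α < β)
    (C₁ C₂ : ℝ) (hC₁ : 0 < C₁) (hC₂ : 0 < C₂) : ∃ c : ℝ, 0 < c ∧ ∀ (E : ℕ → ℝ) (K : ℝ → ℝ),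
    (∀ n, 0 ≤ E n) → Antitone E → (∀ t, 0 < t → 0 ≤ K t) →
    (∀ t, 0 < t → K t ≤ E 0) → (∀ s t, 0 < t → t ≤ s → K t ≤ K s) →
    (∀ s t, 0 < t → t ≤ s → K s ≤ s / t * K t) →
    (∀ n : ℕ, E n ≤ C₁ * K (((n:ℝ) + 1) ^ (-r))) →
    (∀ n : ℕ, ∀ M : ℝ, 0 ≤ M → (∀ k ≤ n, ((k:ℝ) + 1) ^ β * E k ≤ M) →
      K (((n:ℝ) + 1) ^ (-r)) ≤ C₂ * M * ((n:ℝ) + 1) ^ (-β)) →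
    (∫⁻ t in Set.Ioi (0 : ℝ), ENNReal.ofReal ((t ^ (-(α / r)) * K t) ^ p / t)) ≤
      ENNReal.ofReal c * ∑' n : ℕ, ENNReal.ofReal (((n:ℝ) + 1) ^ (α * p - 1) * E n ^ p) ∧
    (∑' n : ℕ, ENNReal.ofReal (((n:ℝ) + 1) ^ (α * p - 1) * E n ^ p)) ≤
      ENNReal.ofReal c *
        ∫⁻ t in Set.Ioi (0 : ℝ), ENNReal.ofReal ((t ^ (-(α / r)) * K t) ^ p / t) := by
  obtain ⟨H, hH, hardy'⟩ := hardy r α p hα hp β hβ C₂ hC₂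
  obtain ⟨A, hA, hd⟩ := rp_diff_neg r hr
  obtain ⟨D, hD, hDint⟩ : ∃ D : ℝ, 0 ≤ D ∧
      ∫⁻ t in Set.Ioi (1:ℝ), ENNReal.ofReal (t ^ (-(α / r) * p - 1)) = ENNReal.ofReal D := by
    have hint : MeasureTheory.IntegrableOn (fun t : ℝ => t ^ (-(α / r) * p - 1)) (Set.Ioi 1) :=
      integrableOn_Ioi_rpow_of_lt (by
        have : 0 < α / r * p := by positivity
        linarith) one_pos
    refine ⟨_, ?_, (MeasureTheory.ofReal_integral_eq_lintegral_ofReal hint ?_).symm⟩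
    · apply MeasureTheory.setIntegral_nonneg measurableSet_Ioi
      intro t ht
      exact Real.rpow_nonneg (le_trans zero_le_one (le_of_lt ht)) _
    · refine (MeasureTheory.ae_restrict_iff' measurableSet_Ioi).2 (Filter.Eventually.of_forall ?_)
      intro t ht
      exact Real.rpow_nonneg (le_trans zero_le_one (le_of_lt ht)) _
  set c₁ : ℝ := D + (2 ^ α) ^ p * 2 ^ r * A * H with hc₁
  set c₂ : ℝ := C₁ ^ p * (A * (2 ^ r) ^ p) with hc₂
  have hc₁0 : 0 < c₁ := by positivity
  have hc₂0 : 0 < c₂ := by positivity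
  refine ⟨c₁ + c₂, by positivity, fun E K hE0 hE hK0 h0 h1 h2 h3 h4 => ?_⟩
  set F : ℝ → ℝ≥0∞ := fun t => ENNReal.ofReal ((t ^ (-(α / r)) * K t) ^ p / t) with hF
  set W : ℝ≥0∞ := ∑' n : ℕ, ENNReal.ofReal (((n:ℝ) + 1) ^ (α * p - 1) * E n ^ p) with hW
  set I : ℕ → Set ℝ := fun n => Set.Ioc (((n:ℝ) + 1 + 1) ^ (-r)) (((n:ℝ) + 1) ^ (-r)) with hI
  set k : ℕ → ℝ := fun n => K (((n:ℝ) + 1) ^ (-r)) with hk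
  have hk0 : ∀ n, 0 ≤ k n := fun n => hK0 _ (by positivity)
  have hvol : ∀ n, MeasureTheory.volume (I n) =
      ENNReal.ofReal (((n:ℝ) + 1) ^ (-r) - ((n:ℝ) + 1 + 1) ^ (-r)) := fun n => Real.volume_Ioc
  have hn1 : ∀ n : ℕ, (1:ℝ) ≤ (n:ℝ) + 1 := fun n => by
    have := Nat.cast_nonneg (α := ℝ) n; linarith
  have hgk : ∀ n : ℕ, ((n:ℝ) + 1) ^ r * (((n:ℝ) + 1) ^ (-r - 1) * (((n:ℝ) + 1) ^ α * k n) ^ p) =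
      ((n:ℝ) + 1) ^ (α * p - 1) * k n ^ p := by
    intro n
    rw [Real.mul_rpow (by positivity) (hk0 n), ← Real.rpow_mul (by positivity), ← mul_assoc,
      ← mul_assoc, ← Real.rpow_add (by positivity), ← Real.rpow_add (by positivity)]
    congr 2; ring
  constructor
  · have hsub : Set.Ioi (0:ℝ) ⊆ Set.Ioi 1 ∪ ⋃ n, I n := by
      intro t ht
      rcases le_or_gt t 1 with h | h
      · right; exact Set.mem_iUnion.2 (I_cover r hr t ht h)
      · left; exact h
    have hfar : ∫⁻ t in Set.Ioi (1:ℝ), F t ≤ ENNReal.ofReal D * W := by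
      calc ∫⁻ t in Set.Ioi (1:ℝ), F t
          ≤ ∫⁻ t in Set.Ioi (1:ℝ), ENNReal.ofReal (E 0 ^ p) * ENNReal.ofReal (t ^ (-(α / r) * p - 1)) := by
            refine MeasureTheory.setLIntegral_mono' measurableSet_Ioi fun t ht => ?_
            have ht0 : 0 < t := lt_trans one_pos ht
            rw [← ENNReal.ofReal_mul (Real.rpow_nonneg (hE0 0) p)]
            apply ENNReal.ofReal_le_ofReal
            rw [Real.mul_rpow (by positivity) (hK0 t ht0), ← Real.rpow_mul ht0.le,
              Real.rpow_sub_one ht0.ne']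
            have hKE := Real.rpow_le_rpow (hK0 t ht0) (h0 t ht0) hp.le
            calc t ^ (-(α / r) * p) * K t ^ p / t ≤ t ^ (-(α / r) * p) * E 0 ^ p / t := by gcongr
              _ = _ := by ring
        _ = ENNReal.ofReal (E 0 ^ p) * ENNReal.ofReal D := by
            rw [MeasureTheory.lintegral_const_mul' _ _ ENNReal.ofReal_ne_top, hDint]
        _ ≤ _ := by
            rw [mul_comm]
            gcongr
            refine le_trans ?_ (ENNReal.le_tsum 0)
            simp
    have hnear : ∀ n, ∫⁻ t in I n, F t ≤ ENNReal.ofReal ((2 ^ α) ^ p * 2 ^ r * A) *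
        ENNReal.ofReal (((n:ℝ) + 1) ^ (α * p - 1) * k n ^ p) := by
      intro n
      have hg0 : 0 ≤ ((n:ℝ) + 1) ^ α * k n := mul_nonneg (by positivity) (hk0 n)
      calc ∫⁻ t in I n, F t
          ≤ ∫⁻ t in I n, ENNReal.ofReal ((2 ^ α * (((n:ℝ) + 1) ^ α * k n)) ^ p * (2 ^ r * ((n:ℝ) + 1) ^ r)) := by
            refine MeasureTheory.setLIntegral_mono' measurableSet_Ioc fun t ht => ?_
            obtain ⟨ht0, i1, -, -, i4⟩ := I_facts r α hr hα K hK0 h1 h2 n t ht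
            apply ENNReal.ofReal_le_ofReal
            rw [div_eq_mul_one_div]
            have hG : 0 ≤ t ^ (-(α / r)) * K t := mul_nonneg (by positivity) (hK0 t ht0)
            have := Real.rpow_le_rpow hG i1 hp.le
            gcongr
        _ = ENNReal.ofReal ((2 ^ α * (((n:ℝ) + 1) ^ α * k n)) ^ p * (2 ^ r * ((n:ℝ) + 1) ^ r)) *
            ENNReal.ofReal (((n:ℝ) + 1) ^ (-r) - ((n:ℝ) + 1 + 1) ^ (-r)) := by
            rw [MeasureTheory.setLIntegral_const, hvol]
        _ ≤ _ := by
            rw [← ENNReal.ofReal_mul (by positivity), ← ENNReal.ofReal_mul (by positivity)]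
            apply ENNReal.ofReal_le_ofReal
            rw [← hgk n, Real.mul_rpow (by positivity) hg0]
            calc _ ≤ (2 ^ α) ^ p * (((n:ℝ) + 1) ^ α * k n) ^ p * (2 ^ r * ((n:ℝ) + 1) ^ r) *
                  (A * ((n:ℝ) + 1) ^ (-r - 1)) := by
                  gcongr
                  exact (hd _ (hn1 n)).2
              _ = _ := by ring
    calc ∫⁻ t in Set.Ioi (0:ℝ), F t ≤ ∫⁻ t in Set.Ioi 1 ∪ ⋃ n, I n, F t :=
          MeasureTheory.lintegral_mono_set hsub
      _ ≤ (∫⁻ t in Set.Ioi 1, F t) + ∫⁻ t in ⋃ n, I n, F t := MeasureTheory.lintegral_union_le _ _ _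
      _ ≤ ENNReal.ofReal D * W + ∑' n, ∫⁻ t in I n, F t :=
          add_le_add hfar (MeasureTheory.lintegral_iUnion_le _ _)
      _ ≤ ENNReal.ofReal D * W + ENNReal.ofReal ((2 ^ α) ^ p * 2 ^ r * A) *
          (ENNReal.ofReal H * W) := by
          refine add_le_add le_rfl ((ENNReal.tsum_le_tsum hnear).trans ?_)
          rw [ENNReal.tsum_mul_left]
          exact mul_le_mul' le_rfl (hardy' E K hE0 hE hK0 h4)
      _ = ENNReal.ofReal c₁ * W := by
          rw [← mul_assoc, ← ENNReal.ofReal_mul (by positivity), ← add_mul,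
            ← ENNReal.ofReal_add hD (by positivity)]
      _ ≤ _ := by
          gcongr; linarith
  · have hlow : ∀ n : ℕ, ENNReal.ofReal (((n:ℝ) + 1) ^ (α * p - 1) * E n ^ p) ≤
        ENNReal.ofReal c₂ * ∫⁻ t in I n, F t := by
      intro n
      have hg0 : 0 ≤ ((n:ℝ) + 1) ^ α * k n := mul_nonneg (by positivity) (hk0 n)
      have hcst : ENNReal.ofReal (((2 ^ r)⁻¹ * (((n:ℝ) + 1) ^ α * k n)) ^ p * ((n:ℝ) + 1) ^ r) *
            ENNReal.ofReal (((n:ℝ) + 1) ^ (-r) - ((n:ℝ) + 1 + 1) ^ (-r)) ≤ ∫⁻ t in I n, F t := by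
        rw [← hvol, ← MeasureTheory.setLIntegral_const]
        refine MeasureTheory.setLIntegral_mono' measurableSet_Ioc fun t ht => ?_
        obtain ⟨ht0, -, i2, i3, -⟩ := I_facts r α hr hα K hK0 h1 h2 n t ht
        apply ENNReal.ofReal_le_ofReal
        rw [div_eq_mul_one_div]
        have i2' : (2 ^ r)⁻¹ * (((n:ℝ) + 1) ^ α * k n) ≤ t ^ (-(α / r)) * K t := by
          rw [inv_mul_le_iff₀ (by positivity)]; exact i2
        have hG : 0 ≤ t ^ (-(α / r)) * K t := mul_nonneg (by positivity) (hK0 t ht0)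
        have := Real.rpow_le_rpow (by positivity) i2' hp.le
        gcongr
      refine le_trans ?_ (mul_le_mul' le_rfl hcst)
      rw [← ENNReal.ofReal_mul (by positivity), ← ENNReal.ofReal_mul (by positivity)]
      apply ENNReal.ofReal_le_ofReal
      have hEn := Real.rpow_le_rpow (hE0 n) (h3 n) hp.le
      rw [Real.mul_rpow hC₁.le (hk0 n)] at hEn
      calc ((n:ℝ) + 1) ^ (α * p - 1) * E n ^ p
          ≤ ((n:ℝ) + 1) ^ (α * p - 1) * (C₁ ^ p * k n ^ p) := by gcongr
        _ = C₁ ^ p * (((n:ℝ) + 1) ^ r * (((n:ℝ) + 1) ^ (-r - 1) * (((n:ℝ) + 1) ^ α * k n) ^ p)) := by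
            rw [hgk n]; ring
        _ ≤ C₁ ^ p * (((n:ℝ) + 1) ^ r * ((A * (((n:ℝ) + 1) ^ (-r) - ((n:ℝ) + 1 + 1) ^ (-r))) * (((n:ℝ) + 1) ^ α * k n) ^ p)) := by
            gcongr
            exact (hd _ (hn1 n)).1
        _ = _ := by
            rw [Real.mul_rpow (by positivity) hg0, Real.inv_rpow (by positivity), hc₂]
            field_simp
    have hanti : Antitone (fun n : ℕ => ((n:ℝ) + 1) ^ (-r)) := by
      intro m n hmn
      exact Real.rpow_le_rpow_of_nonpos (by positivity) (by gcongr) (by linarith)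
    have hdisj : Pairwise (Function.onFun Disjoint I) := by
      have := hanti.pairwise_disjoint_on_Ioc_succ
      simpa [hI] using this
    calc W ≤ ∑' n, ENNReal.ofReal c₂ * ∫⁻ t in I n, F t := ENNReal.tsum_le_tsum hlow
      _ = ENNReal.ofReal c₂ * ∫⁻ t in ⋃ n, I n, F t := by
          rw [ENNReal.tsum_mul_left, MeasureTheory.lintegral_iUnion (fun n => measurableSet_Ioc) hdisj]
      _ ≤ ENNReal.ofReal (c₁ + c₂) * ∫⁻ t in Set.Ioi (0:ℝ), F t := by
          gcongr
          · linarith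
          · intro t ht
            obtain ⟨n, hn⟩ := Set.mem_iUnion.1 ht
            exact lt_trans (show (0:ℝ) < ((n:ℝ) + 1 + 1) ^ (-r) by positivity) hn.1

lemma Ynorm_nonneg (S : ApproximationScheme X) (r : ℝ) (ν : ℝ≥0∞) (f : X) : 0 ≤ Ynorm S r ν f :=
  add_nonneg (norm_nonneg _) ENNReal.toReal_nonneg

lemma apNorm_zero (S : ApproximationScheme X) (r : ℝ) (hr : 0 < r) (ν : ℝ≥0∞) (hν : 0 < ν) :
    apNorm S r ν (0:X) = 0 := by
  obtain ⟨C, hC, h⟩ := bern_gen S r 0 hr hr ν hν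
  have := h 0 0 (A_zero S 1) 0 le_rfl (by
    intro k _
    rw [ae_eq_zero S (A_zero S 0) (Nat.zero_le k), mul_zero])
  simpa using this

lemma K_le (S : ApproximationScheme X) (r : ℝ) (ν : ℝ≥0∞) (f : X) (t : ℝ) (ht : 0 < t) (g : X)
    (hg : apNorm S r ν g ≠ ∞) : KfunY S r ν f t ≤ ‖f - g‖ + t * Ynorm S r ν g := by
  refine csInf_le ⟨0, ?_⟩ ⟨g, hg, rfl⟩
  rintro _ ⟨g, -, rfl⟩
  have := Ynorm_nonneg S r ν g
  positivity

lemma K_ge (S : ApproximationScheme X) (r : ℝ) (hr : 0 < r) (ν : ℝ≥0∞) (hν : 0 < ν) (f : X)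
    (t : ℝ) {b : ℝ}
    (h : ∀ g, apNorm S r ν g ≠ ∞ → b ≤ ‖f - g‖ + t * Ynorm S r ν g) : b ≤ KfunY S r ν f t := by
  refine le_csInf ⟨_, 0, by rw [apNorm_zero S r hr ν hν]; simp, rfl⟩ ?_
  rintro _ ⟨g, hg, rfl⟩
  exact h g hg

lemma K_upper (S : ApproximationScheme X) (r β : ℝ) (hr : 0 < r) (hβ0 : 0 < β) (hβ : β < r)
    (ν : ℝ≥0∞) (hν : 0 < ν) : ∃ C : ℝ, 0 < C ∧ ∀ f : X, ∀ n : ℕ, ∀ M : ℝ, 0 ≤ M →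
      (∀ k ≤ n, ((k:ℝ) + 1) ^ β * approxError S f k ≤ M) →
      KfunY S r ν f (((n:ℝ) + 1) ^ (-r)) ≤ C * M * ((n:ℝ) + 1) ^ (-β) := by
  obtain ⟨C, hC, hb⟩ := bern_gen S r β hr hβ ν hν
  refine ⟨5 + 3 * C, by positivity, fun f n M hM H => ?_⟩
  have key : ∀ M : ℝ, 0 < M → (∀ k ≤ n, ((k:ℝ) + 1) ^ β * approxError S f k ≤ M) →
      KfunY S r ν f (((n:ℝ) + 1) ^ (-r)) ≤ (5 + 3 * C) * M * ((n:ℝ) + 1) ^ (-β) := by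
    intro M hM H
    have hle : ∀ k ≤ n, approxError S f k ≤ M * ((k:ℝ) + 1) ^ (-β) := by
      intro k hk
      rw [Real.rpow_neg (by positivity), ← div_eq_mul_inv, le_div_iff₀' (by positivity)]
      exact H k hk
    obtain ⟨a, ha, hfa⟩ := ae_exists S f (n + 1) (e := M * ((n:ℝ) + 1) ^ (-β)) (by positivity)
    have hfa2 : ‖f - a‖ ≤ 2 * (M * ((n:ℝ) + 1) ^ (-β)) := by
      have := ae_anti S f (Nat.le_succ n)
      have := hle n le_rfl
      simp only [Nat.succ_eq_add_one] at *
      linarith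
    have hak : ∀ k ≤ n, ((k:ℝ) + 1) ^ β * approxError S a k ≤ 3 * M := by
      intro k hk
      have h1 := ae_lip S a f k
      rw [norm_sub_rev] at h1
      have h2 := H k hk
      have h3 : ((k:ℝ) + 1) ^ β * ((n:ℝ) + 1) ^ (-β) ≤ 1 := by
        rw [Real.rpow_neg (by positivity), ← div_eq_mul_inv, div_le_one (by positivity)]
        gcongr
      calc ((k:ℝ) + 1) ^ β * approxError S a k
          ≤ ((k:ℝ) + 1) ^ β * (2 * (M * ((n:ℝ) + 1) ^ (-β)) + approxError S f k) := by
            gcongr; linarith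
        _ = 2 * M * (((k:ℝ) + 1) ^ β * ((n:ℝ) + 1) ^ (-β)) + ((k:ℝ) + 1) ^ β * approxError S f k := by ring
        _ ≤ 2 * M * 1 + M := by gcongr
        _ = _ := by ring
    have hap := hb n a ha (3 * M) (by positivity) hak
    have hapt : apNorm S r ν a ≠ ∞ := ne_top_of_le_ne_top ENNReal.ofReal_ne_top hap
    have hap' := ENNReal.toReal_le_of_le_ofReal (by positivity) hap
    have hna : ‖a‖ ≤ 3 * M := by
      have := hak 0 (Nat.zero_le n)
      simpa [ae_zero] using this
    have h1r : (1:ℝ) ≤ ((n:ℝ) + 1) ^ (r - β) :=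
      Real.one_le_rpow (by have := Nat.cast_nonneg (α := ℝ) n; linarith) (by linarith)
    refine (K_le S r ν f _ (by positivity) a hapt).trans ?_
    have hY : Ynorm S r ν a ≤ (3 + 3 * C) * M * ((n:ℝ) + 1) ^ (r - β) := by
      rw [Ynorm]
      have : 3 * M * 1 ≤ 3 * M * ((n:ℝ) + 1) ^ (r - β) := by gcongr
      linarith
    have hmul : ((n:ℝ) + 1) ^ (-r) * ((n:ℝ) + 1) ^ (r - β) = ((n:ℝ) + 1) ^ (-β) := by
      rw [← Real.rpow_add (by positivity)]; congr 1; ring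
    calc _ ≤ 2 * (M * ((n:ℝ) + 1) ^ (-β)) +
          ((n:ℝ) + 1) ^ (-r) * ((3 + 3 * C) * M * ((n:ℝ) + 1) ^ (r - β)) := by gcongr
      _ = 2 * (M * ((n:ℝ) + 1) ^ (-β)) + (3 + 3 * C) * M * (((n:ℝ) + 1) ^ (-r) * ((n:ℝ) + 1) ^ (r - β)) := by ring
      _ = _ := by rw [hmul]; ring
  rcases hM.eq_or_lt with h | h
  · have h00 := H 0 (Nat.zero_le n)
    rw [ae_zero, ← h] at h00
    simp at h00
    rw [← h]
    refine (K_le S r ν f _ (by positivity) 0 (by rw [apNorm_zero S r hr ν hν]; simp)).trans ?_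
    simp [Ynorm, apNorm_zero S r hr ν hν, h00]
  · exact key M h H

lemma bernstein_ineq (S : ApproximationScheme X) (r : ℝ) (hr : 0 < r) (ν : ℝ≥0∞) (hν : 0 < ν) :
    ∃ C₂ : ℝ, 0 < C₂ ∧ ∀ n : ℕ, 1 ≤ n → ∀ g ∈ S.A n,
      apNorm S r ν g ≠ ∞ ∧ Ynorm S r ν g ≤ C₂ * (n : ℝ) ^ r * ‖g‖ := by
  obtain ⟨C, hC, hb⟩ := bern_gen S r 0 hr hr ν hν
  refine ⟨1 + C, by positivity, fun n hn g hg => ?_⟩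
  obtain ⟨m, rfl⟩ : ∃ m, n = m + 1 := ⟨n - 1, by omega⟩
  have hap := hb m g hg ‖g‖ (norm_nonneg _) (by
    intro k _
    rw [Real.rpow_zero, one_mul, ← ae_zero S g]
    exact ae_anti S g (Nat.zero_le k))
  refine ⟨ne_top_of_le_ne_top ENNReal.ofReal_ne_top hap, ?_⟩
  have hap' := ENNReal.toReal_le_of_le_ofReal (by positivity) hap
  rw [sub_zero] at hap'
  have h1r : (1:ℝ) ≤ ((m:ℝ) + 1) ^ r :=
    Real.one_le_rpow (by have := Nat.cast_nonneg (α := ℝ) m; linarith) hr.le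
  rw [Ynorm]
  push_cast
  have := mul_le_mul_of_nonneg_right h1r (norm_nonneg g)
  nlinarith

lemma rpow_transfer {p c : ℝ} (hp : 0 < p) (hc : 0 < c) {a b : ℝ≥0∞}
    (h : a ≤ ENNReal.ofReal c * b) :
    a ^ (1 / p) ≤ ENNReal.ofReal (c ^ (1 / p)) * b ^ (1 / p) := by
  rw [← ENNReal.ofReal_rpow_of_pos hc, ← ENNReal.mul_rpow_of_nonneg _ _ (by positivity)]
  exact ENNReal.rpow_le_rpow h (by positivity)

lemma interp_equiv (S : ApproximationScheme X)
    (r : ℝ) (hr : 0 < r) (ν : ℝ≥0∞) (hν : 0 < ν) (α : ℝ) (hα : 0 < α) (hαr : α < r)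
    (μ : ℝ≥0∞) (hμ : 0 < μ) : ∃ c : ℝ, 0 < c ∧ ∀ f : X,
      interpNormY S r ν (α / r) μ f ≤ ENNReal.ofReal c * apNorm S α μ f ∧
      apNorm S α μ f ≤ ENNReal.ofReal c * interpNormY S r ν (α / r) μ f := by
  obtain ⟨C₁, hC₁, hJ⟩ := jackson S r hr ν hν
  obtain ⟨C₂, hC₂, h4⟩ := K_upper S r ((α + r) / 2) hr (by linarith) (by linarith) ν hν
  have hK0 : ∀ f : X, ∀ t, 0 < t → 0 ≤ KfunY S r ν f t := fun f t ht =>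
    K_ge S r hr ν hν f t fun g _ => by
      have := Ynorm_nonneg S r ν g
      positivity
  have h0 : ∀ f : X, ∀ t, 0 < t → KfunY S r ν f t ≤ approxError S f 0 := fun f t ht => by
    refine (K_le S r ν f t ht 0 (by rw [apNorm_zero S r hr ν hν]; simp)).trans ?_
    simp [Ynorm, apNorm_zero S r hr ν hν, ae_zero]
  have h1 : ∀ f : X, ∀ s t, 0 < t → t ≤ s → KfunY S r ν f t ≤ KfunY S r ν f s := fun f s t ht hts =>
    K_ge S r hr ν hν f s fun g hg => by
      refine (K_le S r ν f t ht g hg).trans ?_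
      have := Ynorm_nonneg S r ν g
      gcongr
  have h2 : ∀ f : X, ∀ s t, 0 < t → t ≤ s → KfunY S r ν f s ≤ s / t * KfunY S r ν f t := by
    intro f s t ht hts
    have hs : 0 < s := ht.trans_le hts
    rw [← div_le_iff₀' (by positivity)]
    refine K_ge S r hr ν hν f t fun g hg => ?_
    rw [div_le_iff₀' (by positivity)]
    refine (K_le S r ν f s hs g hg).trans ?_
    have h1 : 1 ≤ s / t := (one_le_div ht).2 hts
    have : s / t * (‖f - g‖ + t * Ynorm S r ν g) = s / t * ‖f - g‖ + s * Ynorm S r ν g := by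
      field_simp
    rw [this]
    nlinarith [norm_nonneg (f - g)]
  have h3 : ∀ f : X, ∀ n : ℕ, approxError S f n ≤ (1 + C₁) * KfunY S r ν f (((n:ℝ) + 1) ^ (-r)) := by
    intro f n
    rw [← div_le_iff₀' (by positivity)]
    refine K_ge S r hr ν hν f _ fun g hg => ?_
    rw [div_le_iff₀' (by positivity)]
    have ha := ae_lip S f g n
    have hb := hJ g hg n
    have hc := mul_nonneg hC₁.le (norm_nonneg (f - g))
    have hd : 0 ≤ ((n:ℝ) + 1) ^ (-r) * Ynorm S r ν g :=
      mul_nonneg (by positivity) (Ynorm_nonneg S r ν g)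
    nlinarith
  by_cases h : μ = ∞
  · subst h
    obtain ⟨c, hc, H⟩ := interp_top r α hr hα ((α + r) / 2) (by linarith) (1 + C₁) C₂
      (by positivity) hC₂
    refine ⟨c, hc, fun f => ?_⟩
    have := H (approxError S f) (KfunY S r ν f) (ae_nonneg S f) (ae_anti S f) (hK0 f) (h0 f)
      (h1 f) (h2 f) (h3 f) (h4 f)
    rw [apNorm_top]
    simpa only [interpNormY, if_true] using this
  · have hp : 0 < μ.toReal := ENNReal.toReal_pos hμ.ne' h
    obtain ⟨c, hc, H⟩ := interp_fin r α μ.toReal hr hα hp ((α + r) / 2) (by linarith) (1 + C₁) C₂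
      (by positivity) hC₂
    refine ⟨c ^ (1 / μ.toReal), by positivity, fun f => ?_⟩
    obtain ⟨H1, H2⟩ := H (approxError S f) (KfunY S r ν f) (ae_nonneg S f) (ae_anti S f) (hK0 f)
      (h0 f) (h1 f) (h2 f) (h3 f) (h4 f)
    rw [apNorm_fin S α hμ h, interpNormY, if_neg h]
    exact ⟨rpow_transfer hp hc H1, rpow_transfer hp hc H2⟩

/-- For any approximation scheme on a Banach space `X`, `r > 0` and `0 < ν ≤ ∞`, the
space `Y := X^r_ν` (with quasi-norm `‖f‖_Y = ‖f‖_X + ‖(n^{r-1/ν} α_n(f,X))‖_{ℓ_ν}`)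
satisfies the Jackson inequality `α_n(f, X) ≤ C₁ n^{-r} ‖f‖_Y` and the Bernstein
inequality `‖g‖_Y ≤ C₂ n^r ‖g‖_X` for `g ∈ A n`, `n ≥ 1`; consequently for every
`0 < α < r` and `0 < μ₁ ≤ ∞` one has `(X, Y)_{α/r, μ₁} = X^α_{μ₁}` with equivalence of
quasi-norms.  (Here `approxError S f n = α_{n+1}(f, X)`.) -/
theorem approx_space_as_interpolation [CompleteSpace X] (S : ApproximationScheme X)
    (r : ℝ) (hr : 0 < r) (ν : ℝ≥0∞) (hν : 0 < ν) :
    (∃ C₁ : ℝ, 0 < C₁ ∧ ∀ f : X, apNorm S r ν f ≠ ∞ →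
      ∀ n : ℕ, approxError S f n ≤ C₁ * ((n : ℝ) + 1) ^ (-r) * Ynorm S r ν f) ∧
    (∃ C₂ : ℝ, 0 < C₂ ∧ ∀ n : ℕ, 1 ≤ n → ∀ g ∈ S.A n,
      apNorm S r ν g ≠ ∞ ∧ Ynorm S r ν g ≤ C₂ * (n : ℝ) ^ r * ‖g‖) ∧
    (∀ α : ℝ, 0 < α → α < r → ∀ μ₁ : ℝ≥0∞, 0 < μ₁ →
      ∃ c₁ c₂ : ℝ, 0 < c₁ ∧ 0 < c₂ ∧ ∀ f : X,
        ENNReal.ofReal c₁ * interpNormY S r ν (α / r) μ₁ f ≤ apNorm S α μ₁ f ∧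
        apNorm S α μ₁ f ≤ ENNReal.ofReal c₂ * interpNormY S r ν (α / r) μ₁ f) := by
  refine ⟨jackson S r hr ν hν, bernstein_ineq S r hr ν hν, fun α hα hαr μ₁ hμ => ?_⟩
  obtain ⟨c, hc, H⟩ := interp_equiv S r hr ν hν α hα hαr μ₁ hμ
  refine ⟨c⁻¹, c, by positivity, hc, fun f => ⟨?_, (H f).2⟩⟩
  calc _ ≤ ENNReal.ofReal c⁻¹ * (ENNReal.ofReal c * apNorm S α μ₁ f) :=
        mul_le_mul' le_rfl (H f).1
    _ = _ := by
      rw [← mul_assoc, ← ENNReal.ofReal_mul (by positivity), inv_mul_cancel₀ hc.ne',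
        ENNReal.ofReal_one, one_mul]
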